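/- arXiv:1902.04813 — 3 statements merged into one kernel-verified Lean document; each statement's English description precedes it below -/
import Mathlib

section
/- Let 𝕍 be a real Hilbert space, 𝕁 a finite nonempty set, {𝕍_j}_{j∈𝕁} closed linear subspaces of 𝕍 whose (algebraic) sum is 𝕍, and for each j a norm ‖·‖_j on 𝕍_j equivalent to the restriction of the Hilbertian norm to 𝕍_j (i.e. m_j‖v‖ ≤ ‖v‖_j ≤ M_j‖v‖ on 𝕍_j for some 0 < m_j ≤ M_j). Let B_j = {v ∈ 𝕍_j : ‖v‖_j ≤ 1}. Then the function N(v) := inf{ Σ_{j∈𝕁} ‖v^j‖_j : v^j ∈ 𝕍_j for all j, Σ_{j∈𝕁} v^j = v } is a norm on 𝕍, equivalent to the Hilbertian norm, whose closed unit ball {v : N(v) ≤ 1} equals the closed convex hull of ⋃_{j∈𝕁} B_j. -/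
open scoped RealInnerProductSpace

/-- `N : V → ℝ` is a norm: nonnegative, definite, absolutely homogeneous, subadditive. -/
def IsNorm {V : Type*} [NormedAddCommGroup V] [InnerProductSpace ℝ V] (N : V → ℝ) : Prop :=
  (∀ v, 0 ≤ N v) ∧ (∀ v, N v = 0 ↔ v = 0) ∧
  (∀ (c : ℝ) (v : V), N (c • v) = |c| * N v) ∧ (∀ v w, N (v + w) ≤ N v + N w)

/-- `N` is a norm on the subspace `p`, equivalent there to the Hilbertian norm. -/
def IsEquivNormOn {V : Type*} [NormedAddCommGroup V] [InnerProductSpace ℝ V]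
    (p : Submodule ℝ V) (N : V → ℝ) : Prop :=
  (∀ v ∈ p, 0 ≤ N v) ∧ (∀ v ∈ p, (N v = 0 ↔ v = 0)) ∧
  (∀ (c : ℝ), ∀ v ∈ p, N (c • v) = |c| * N v) ∧
  (∀ v ∈ p, ∀ w ∈ p, N (v + w) ≤ N v + N w) ∧
  (∃ m M : ℝ, 0 < m ∧ 0 < M ∧ ∀ v ∈ p, m * ‖v‖ ≤ N v ∧ N v ≤ M * ‖v‖)

theorem stmt_8_aux {V J : Type*} [NormedAddCommGroup V] [InnerProductSpace ℝ V]
    [CompleteSpace V] [Fintype J] [Nonempty J]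
    (p : J → Submodule ℝ V) (hclosed : ∀ j : J, IsClosed (p j : Set V))
    (hsum : ∀ v : V, ∃ c : J → V, (∀ j : J, c j ∈ p j) ∧ ∑ j : J, c j = v)
    (Nj : J → V → ℝ) (hNj : ∀ j : J, IsEquivNormOn (p j) (Nj j)) (N : V → ℝ)
    (hN : ∀ v, N v = sInf {r : ℝ | ∃ c : J → V,
        (∀ j : J, c j ∈ p j) ∧ ∑ j : J, c j = v ∧ r = ∑ j : J, Nj j (c j)}) :
    IsNorm N ∧ (∃ m M : ℝ, 0 < m ∧ 0 < M ∧ ∀ v : V, m * ‖v‖ ≤ N v ∧ N v ≤ M * ‖v‖) ∧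
    {v : V | N v ≤ 1}
      = closure (convexHull ℝ (⋃ j : J, {v : V | v ∈ p j ∧ Nj j v ≤ 1})) := by
  classical
  choose h0 hdef hhom hadd hm using hNj
  choose m M hmpos hMpos hmM using hm
  -- uniform constants
  obtain ⟨m0, hm0, hm0le⟩ : ∃ m0 : ℝ, 0 < m0 ∧ ∀ j, m0 ≤ m j := by
    obtain ⟨i, hi⟩ := Finite.exists_min m
    exact ⟨m i, hmpos i, hi⟩
  obtain ⟨M0, hM0, hM0le⟩ : ∃ M0 : ℝ, 0 < M0 ∧ ∀ j, M j ≤ M0 := by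
    obtain ⟨i, hi⟩ := Finite.exists_max M
    exact ⟨M i, hMpos i, hi⟩
  have hNle : ∀ c : J → V, (∀ j, c j ∈ p j) → N (∑ j, c j) ≤ ∑ j, Nj j (c j) := by
    intro c hc
    rw [hN]
    refine csInf_le ⟨0, ?_⟩ ⟨c, hc, rfl, rfl⟩
    rintro r ⟨d, hd, -, rfl⟩
    exact Finset.sum_nonneg fun j _ => h0 j _ (hd j)
  have hle : ∀ v a, (∀ c : J → V, (∀ j, c j ∈ p j) → ∑ j, c j = v → a ≤ ∑ j, Nj j (c j)) →
      a ≤ N v := by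
    intro v a h
    rw [hN]
    obtain ⟨c, hc, hcv⟩ := hsum v
    refine le_csInf ⟨_, c, hc, hcv, rfl⟩ ?_
    rintro r ⟨d, hd, hdv, rfl⟩
    exact h d hd hdv
  have hlt : ∀ v a, N v < a → ∃ c : J → V, (∀ j, c j ∈ p j) ∧ ∑ j, c j = v ∧
      ∑ j, Nj j (c j) < a := by
    intro v a h
    by_contra hcon
    push Not at hcon
    exact absurd (hle v a hcon) (not_le.mpr h)
  have hlow : ∀ v, m0 * ‖v‖ ≤ N v := by
    intro v
    refine hle v _ ?_
    rintro c hc rfl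
    calc m0 * ‖∑ j, c j‖ ≤ m0 * ∑ j, ‖c j‖ := by
          gcongr; exact norm_sum_le _ _
      _ = ∑ j, m0 * ‖c j‖ := Finset.mul_sum _ _ _
      _ ≤ ∑ j, Nj j (c j) := Finset.sum_le_sum fun j _ =>
          (mul_le_mul_of_nonneg_right (hm0le j) (norm_nonneg _)).trans (hmM j _ (hc j)).1
  have hnn : ∀ v, 0 ≤ N v := fun v => le_trans (by positivity) (hlow v)
  obtain ⟨K, hK, hup⟩ : ∃ K : ℝ, 0 < K ∧ ∀ v, N v ≤ K * ‖v‖ := by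
    haveI : ∀ j, CompleteSpace (p j) := fun j => (hclosed j).completeSpace_coe
    let T : (∀ j, p j) →L[ℝ] V :=
      ∑ j, (p j).subtypeL.comp (ContinuousLinearMap.proj (R := ℝ) (φ := fun j => p j) j)
    have hT : ∀ x, T x = ∑ j, (x j : V) := by
      intro x; simp [T, ContinuousLinearMap.sum_apply]
    have hs : Function.Surjective T := by
      intro v
      obtain ⟨c, hc, hcv⟩ := hsum v
      exact ⟨fun j => ⟨c j, hc j⟩, by rw [hT]; exact hcv⟩
    obtain ⟨C, hC, hpre⟩ := T.exists_preimage_norm_le hs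
    refine ⟨Fintype.card J * (M0 * C), by positivity, fun v => ?_⟩
    obtain ⟨x, hx, hxn⟩ := hpre v
    rw [hT] at hx
    have h1 := hNle (fun j => (x j : V)) (fun j => (x j).2)
    simp only [hx] at h1
    refine h1.trans ?_
    have : ∀ j ∈ Finset.univ, Nj j (x j : V) ≤ M0 * (C * ‖v‖) := by
      intro j _
      have h2 : ‖(x j : V)‖ ≤ C * ‖v‖ := (norm_le_pi_norm x j).trans hxn
      calc Nj j (x j : V) ≤ M j * ‖(x j : V)‖ := (hmM j _ (x j).2).2
        _ ≤ M0 * (C * ‖v‖) := mul_le_mul (hM0le j) h2 (norm_nonneg _) hM0.le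
    refine (Finset.sum_le_sum this).trans (le_of_eq ?_)
    simp; ring
  have hNadd : ∀ v w, N (v + w) ≤ N v + N w := by
    intro v w
    refine le_of_forall_pos_le_add fun ε hε => ?_
    obtain ⟨c, hc, hcv, hcl⟩ := hlt v (N v + ε / 2) (by linarith)
    obtain ⟨d, hd, hdv, hdl⟩ := hlt w (N w + ε / 2) (by linarith)
    have h1 := hNle (fun j => c j + d j) fun j => (p j).add_mem (hc j) (hd j)
    rw [Finset.sum_add_distrib, hcv, hdv] at h1
    have h2 : ∑ j, Nj j (c j + d j) ≤ ∑ j, (Nj j (c j) + Nj j (d j)) :=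
      Finset.sum_le_sum fun j _ => hadd j _ (hc j) _ (hd j)
    rw [Finset.sum_add_distrib] at h2
    linarith
  have hN0 : N 0 = 0 := le_antisymm (by simpa using hup 0) (hnn 0)
  have hsm : ∀ (a : ℝ) v, N (a • v) ≤ |a| * N v := by
    intro a v
    rcases eq_or_ne a 0 with rfl | ha
    · simp [hN0]
    have ha' : 0 < |a| := abs_pos.mpr ha
    rw [← div_le_iff₀' ha']
    refine hle v _ ?_
    rintro c hc rfl
    rw [div_le_iff₀' ha', Finset.smul_sum, Finset.mul_sum]
    refine (hNle (fun j => a • c j) fun j => (p j).smul_mem _ (hc j)).trans (le_of_eq ?_)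
    exact Finset.sum_congr rfl fun j _ => hhom j _ _ (hc j)
  have hNsm : ∀ (a : ℝ) v, N (a • v) = |a| * N v := by
    intro a v
    refine le_antisymm (hsm a v) ?_
    rcases eq_or_ne a 0 with rfl | ha
    · simp [hN0]
    have ha' : 0 < |a| := abs_pos.mpr ha
    have h := hsm a⁻¹ (a • v)
    rw [inv_smul_smul₀ ha, abs_inv] at h
    rwa [← div_eq_inv_mul, le_div_iff₀' ha'] at h
  have hz : ∀ j, Nj j 0 = 0 := fun j => (hdef j 0 (p j).zero_mem).2 rfl
  refine ⟨⟨hnn, fun v => ⟨fun h => ?_, fun h => h ▸ hN0⟩, hNsm, hNadd⟩,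
    ⟨m0, K, hm0, hK, fun v => ⟨hlow v, hup v⟩⟩, ?_⟩
  · have := hlow v
    rw [h] at this
    have h3 : ‖v‖ ≤ 0 := by
      by_contra hc
      push Not at hc
      nlinarith [mul_pos hm0 hc]
    exact norm_le_zero_iff.mp h3
  have hcont : Continuous N := by
    have : LipschitzWith K.toNNReal N := by
      refine LipschitzWith.of_le_add_mul _ fun x y => ?_
      rw [Real.coe_toNNReal _ hK.le, dist_eq_norm]
      have h1 := hNadd y (x - y)
      rw [add_sub_cancel] at h1
      linarith [hup (x - y)]
    exact this.continuous
  have hball : Convex ℝ {v : V | N v ≤ 1} := by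
    intro x hx y hy a b ha hb hab
    simp only [Set.mem_setOf_eq] at *
    have h1 := hNadd (a • x) (b • y)
    rw [hNsm, hNsm, abs_of_nonneg ha, abs_of_nonneg hb] at h1
    nlinarith
  set S : Set V := ⋃ j : J, {v : V | v ∈ p j ∧ Nj j v ≤ 1} with hS
  have h0S : (0 : V) ∈ S := by
    obtain ⟨j⟩ := ‹Nonempty J›
    exact Set.mem_iUnion.2 ⟨j, (p j).zero_mem, by rw [hz]; norm_num⟩
  have hopen : ∀ v, N v < 1 → v ∈ convexHull ℝ S := by
    intro v hv
    obtain ⟨c, hc, rfl, hcl⟩ := hlt v 1 hv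
    let w : Option J → ℝ := fun o => o.elim (1 - ∑ j, Nj j (c j)) fun j => Nj j (c j)
    let z : Option J → V := fun o => o.elim 0 fun j => (Nj j (c j))⁻¹ • c j
    have key := (convex_convexHull ℝ S).sum_mem (t := Finset.univ) (w := w) (z := z)
      (by
        rintro (_ | j) _
        · simp only [w, Option.elim]; linarith
        · exact h0 j _ (hc j))
      (by simp [w, Fintype.sum_option])
      (by
        rintro (_ | j) _
        · exact subset_convexHull ℝ S h0S
        · refine subset_convexHull ℝ S (Set.mem_iUnion.2 ⟨j, (p j).smul_mem _ (hc j), ?_⟩)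
          change Nj j ((Nj j (c j))⁻¹ • c j) ≤ 1
          rw [hhom j _ _ (hc j), abs_of_nonneg (inv_nonneg.2 (h0 j _ (hc j)))]
          exact inv_mul_le_one)
    rw [Fintype.sum_option] at key
    convert key using 1
    simp only [w, z, Option.elim, smul_zero, zero_add]
    refine Finset.sum_congr rfl fun j _ => ?_
    by_cases hj : Nj j (c j) = 0
    · rw [(hdef j _ (hc j)).1 hj]; simp
    · rw [smul_inv_smul₀ hj]
  apply Set.Subset.antisymm
  · intro v hv
    have hv' : N v ≤ 1 := hv
    have ht : Filter.Tendsto (fun t : ℝ => t • v) (nhdsWithin 1 (Set.Ioo 0 1)) (nhds v) := by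
      have : Filter.Tendsto (fun t : ℝ => t • v) (nhds 1) (nhds ((1 : ℝ) • v)) :=
        (continuous_id.smul continuous_const).tendsto 1
      rw [one_smul] at this
      exact this.mono_left nhdsWithin_le_nhds
    haveI : (nhdsWithin (1 : ℝ) (Set.Ioo 0 1)).NeBot := right_nhdsWithin_Ioo_neBot one_pos
    refine mem_closure_of_tendsto ht ?_
    filter_upwards [self_mem_nhdsWithin] with t ht
    apply hopen
    rw [hNsm, abs_of_pos ht.1]
    nlinarith [ht.1, ht.2]
  · refine closure_minimal (convexHull_min ?_ hball) (isClosed_le hcont continuous_const)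
    intro v hv
    obtain ⟨j, hj, hj1⟩ := Set.mem_iUnion.1 hv
    have h1 := hNle (Pi.single j v) (by
      intro i
      rcases eq_or_ne i j with rfl | h
      · simpa using hj
      · rw [Pi.single_eq_of_ne h]; exact (p i).zero_mem)
    have h2 : ∑ i, (Pi.single j v : J → V) i = v := by simp
    have h3 : ∑ i, Nj i ((Pi.single j v : J → V) i) = Nj j v := by
      rw [Finset.sum_eq_single j]
      · simp
      · intro i _ h
        rw [Pi.single_eq_of_ne h, hz]
      · simp
    rw [h2, h3] at h1
    exact h1.trans hj1

/-- `𝕍` a real Hilbert space, `𝕁` finite nonempty, `{𝕍_j}` closed subspaces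
with algebraic sum `𝕍`, and `‖·‖_j` a norm on `𝕍_j` equivalent to the restricted
Hilbertian norm, with unit ball `B_j`.  Then
`N(v) = inf { Σ_j ‖v^j‖_j : v^j ∈ 𝕍_j, Σ_j v^j = v }` is a norm on `𝕍`, equivalent to
the Hilbertian norm, whose closed unit ball equals the closed convex hull of `⋃_j B_j`. -/
theorem stmt_8 {V J : Type*} [NormedAddCommGroup V] [InnerProductSpace ℝ V]
    [CompleteSpace V] [Fintype J] [Nonempty J]
    (p : J → Submodule ℝ V) (hclosed : ∀ j : J, IsClosed (p j : Set V))
    (hsum : ∀ v : V, ∃ c : J → V, (∀ j : J, c j ∈ p j) ∧ ∑ j : J, c j = v)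
    (Nj : J → V → ℝ) (hNj : ∀ j : J, IsEquivNormOn (p j) (Nj j)) :
    IsNorm (fun v : V => sInf {r : ℝ | ∃ c : J → V,
        (∀ j : J, c j ∈ p j) ∧ ∑ j : J, c j = v ∧ r = ∑ j : J, Nj j (c j)}) ∧
    (∃ m M : ℝ, 0 < m ∧ 0 < M ∧ ∀ v : V,
        m * ‖v‖ ≤ sInf {r : ℝ | ∃ c : J → V,
            (∀ j : J, c j ∈ p j) ∧ ∑ j : J, c j = v ∧ r = ∑ j : J, Nj j (c j)} ∧
        sInf {r : ℝ | ∃ c : J → V,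
            (∀ j : J, c j ∈ p j) ∧ ∑ j : J, c j = v ∧ r = ∑ j : J, Nj j (c j)}
          ≤ M * ‖v‖) ∧
    {v : V | sInf {r : ℝ | ∃ c : J → V,
        (∀ j : J, c j ∈ p j) ∧ ∑ j : J, c j = v ∧ r = ∑ j : J, Nj j (c j)} ≤ 1}
      = closure (convexHull ℝ (⋃ j : J, {v : V | v ∈ p j ∧ Nj j v ≤ 1})) := by
  exact stmt_8_aux p hclosed hsum Nj hNj _ (fun _ => rfl)
end

section
/- Let 𝕍 be a real Hilbert space, 𝕁 a finite nonempty set, {𝕍_j}_{j∈𝕁} closed linear subspaces of 𝕍 whose (algebraic) sum is 𝕍, and for each j a norm ‖·‖_j on 𝕍_j equivalent to the restriction of the Hilbertian norm to 𝕍_j, with unit ball B_j = {v ∈ 𝕍_j : ‖v‖_j ≤ 1}. Let N be the norm on 𝕍 whose unit ball is the closed convex hull of ⋃_{j∈𝕁} B_j, and for u ∈ 𝕍_j define the local dual norm ‖u‖_{j,⋆} = sup{⟪v,u⟫ : v ∈ B_j}. Then the dual norm N⋆ of N satisfies, for every v' ∈ 𝕍, N⋆(v') = sup{⟪v,v'⟫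 : N(v) ≤ 1} = max_{j∈𝕁} ‖π_j(v')‖_{j,⋆}, where π_j is the orthogonal projection of 𝕍 onto 𝕍_j; moreover N⋆ is a norm equivalent to the Hilbertian norm, with unit ball the polar set (⋃_{j∈𝕁} B_j)°. -/
open scoped RealInnerProductSpace

/-- The polar of `A`: `A° = {y : ⟪x,y⟫ ≤ 1 for all x ∈ A}`. -/
def polarSet {V : Type*} [NormedAddCommGroup V] [InnerProductSpace ℝ V] (A : Set V) :
    Set V := {y | ∀ x ∈ A, ⟪x, y⟫ ≤ 1}

lemma aux_coe_iSup {V : Type*} (A : Set V) (f : V → ℝ) (r : ℝ) (h : IsLUB (f '' A) r) :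
    (r : EReal) = ⨆ v ∈ A, (f v : EReal) := by
  apply le_antisymm
  · apply le_of_forall_lt
    intro c hc
    obtain ⟨x, hcx, hxr⟩ := EReal.lt_iff_exists_real_btwn.1 hc
    have hxr' : x < r := by exact_mod_cast hxr
    obtain ⟨_, ⟨a, ha, rfl⟩, hxa, _⟩ := h.exists_between hxr'
    have h1 : (x : EReal) < (f a : EReal) := by exact_mod_cast hxa
    exact (hcx.trans h1).trans_le (le_iSup₂ (f := fun v (_ : v ∈ A) => (f v : EReal)) a ha)
  · refine iSup₂_le fun a ha => ?_
    exact_mod_cast h.1 ⟨a, ha, rfl⟩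

lemma aux_bound {V : Type*} [NormedAddCommGroup V] [InnerProductSpace ℝ V]
    [CompleteSpace V] (N : V → ℝ) (hN : IsNorm N) (hcl : IsClosed {v : V | N v ≤ 1}) :
    ∃ C : ℝ, 0 < C ∧ ∀ v, N v ≤ C * ‖v‖ := by
  obtain ⟨h0, hd, hh, ht⟩ := hN
  let q : Seminorm ℝ V := Seminorm.of N ht (by intro a x; simpa using hh a x)
  have hq : LowerSemicontinuous q := by
    rw [lowerSemicontinuous_iff_isClosed_preimage]
    intro r
    change IsClosed {x : V | N x ≤ r}
    rcases lt_trichotomy r 0 with hr | hr | hr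
    · have : {x : V | N x ≤ r} = ∅ := by
        ext x
        simpa using hr.trans_le (h0 x)
      rw [this]; exact isClosed_empty
    · have : {x : V | N x ≤ r} = {0} := by
        ext x
        simp only [Set.mem_setOf_eq, Set.mem_singleton_iff, hr]
        rw [← hd x]
        exact ⟨fun h => le_antisymm h (h0 x), fun h => h.le⟩
      rw [this]; exact isClosed_singleton
    · have : {x : V | N x ≤ r} = (fun x : V => r⁻¹ • x) ⁻¹' {v : V | N v ≤ 1} := by
        ext x
        simp only [Set.mem_setOf_eq, Set.mem_preimage, hh, abs_of_pos (inv_pos.2 hr)]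
        rw [inv_mul_le_iff₀ hr, mul_one]
      rw [this]; exact hcl.preimage (continuous_const_smul _)
  have hc : Continuous q := q.continuous_of_lowerSemicontinuous hq
  obtain ⟨C, hC, hb⟩ := Seminorm.bound_of_continuous_normedSpace q hc
  exact ⟨C, hC, hb⟩

/-- in the setting of Statement 8 (closed subspaces `𝕍_j` with algebraic sum
`𝕍`, local norms `‖·‖_j` with unit balls `B_j`), let `N` be the norm whose unit ball is
the closed convex hull of `⋃_j B_j`, and let `π_j` be the orthogonal projection onto
`𝕍_j`.  Then the dual norm `N⋆(v') = sup {⟪v,v'⟫ : N v ≤ 1}` satisfies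
`N⋆(v') = max_j ‖π_j v'‖_{j,⋆}` with `‖u‖_{j,⋆} = sup {⟪v,u⟫ : v ∈ B_j}`; moreover `N⋆`
is a norm equivalent to the Hilbertian norm with unit ball `(⋃_j B_j)°`.
(Finiteness of suprema is expressed by equality in `EReal` with a real value.) -/
theorem stmt_9 {V J : Type*} [NormedAddCommGroup V] [InnerProductSpace ℝ V]
    [CompleteSpace V] [Fintype J] [Nonempty J]
    (p : J → Submodule ℝ V) (hclosed : ∀ j : J, IsClosed (p j : Set V))
    (hsum : ∀ v : V, ∃ c : J → V, (∀ j : J, c j ∈ p j) ∧ ∑ j : J, c j = v)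
    (Nj : J → V → ℝ) (hNj : ∀ j : J, IsEquivNormOn (p j) (Nj j))
    (N : V → ℝ) (hN : IsNorm N)
    (hball : {v : V | N v ≤ 1}
      = closure (convexHull ℝ (⋃ j : J, {v : V | v ∈ p j ∧ Nj j v ≤ 1})))
    (π : J → V → V)
    (hπ : ∀ j : J, ∀ v : V, π j v ∈ p j ∧ ∀ u ∈ p j, ⟪v - π j v, u⟫ = 0) :
    ∃ Nstar : V → ℝ,
      (∀ v' : V, (Nstar v' : EReal) = ⨆ v ∈ {v : V | N v ≤ 1}, (⟪v, v'⟫ : EReal)) ∧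
      (∀ v' : V, (Nstar v' : EReal)
        = ⨆ j : J, ⨆ v ∈ {v : V | v ∈ p j ∧ Nj j v ≤ 1}, (⟪v, π j v'⟫ : EReal)) ∧
      IsNorm Nstar ∧
      (∃ m M : ℝ, 0 < m ∧ 0 < M ∧ ∀ v : V, m * ‖v‖ ≤ Nstar v ∧ Nstar v ≤ M * ‖v‖) ∧
      {y : V | Nstar y ≤ 1} = polarSet (⋃ j : J, {v : V | v ∈ p j ∧ Nj j v ≤ 1}) := by
  classical
  set U : Set V := ⋃ j : J, {v : V | v ∈ p j ∧ Nj j v ≤ 1} with hU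
  have hmemU : ∀ x, x ∈ U ↔ ∃ j, x ∈ p j ∧ Nj j x ≤ 1 := by intro x; simp [hU]
  have h0U : (0 : V) ∈ U := by
    obtain ⟨j⟩ := ‹Nonempty J›
    refine (hmemU 0).2 ⟨j, (p j).zero_mem, ?_⟩
    rw [((hNj j).2.1 0 (p j).zero_mem).2 rfl]
    exact zero_le_one
  have hneg : ∀ x ∈ U, -x ∈ U := by
    intro x hx
    obtain ⟨j, hj, hx1⟩ := (hmemU x).1 hx
    refine (hmemU _).2 ⟨j, (p j).neg_mem hj, ?_⟩
    have := (hNj j).2.2.1 (-1) x hj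
    rw [neg_one_smul] at this
    rw [this]; simpa using hx1
  obtain ⟨R, hR, hUR⟩ : ∃ R : ℝ, 0 < R ∧ ∀ x ∈ U, ‖x‖ ≤ R := by
    choose m M hm hM hb using fun j => (hNj j).2.2.2.2
    refine ⟨∑ j, (m j)⁻¹, Finset.sum_pos (fun j _ => inv_pos.2 (hm j)) Finset.univ_nonempty, ?_⟩
    intro x hx
    obtain ⟨j, hj, hx1⟩ := (hmemU x).1 hx
    have h1 : ‖x‖ ≤ (m j)⁻¹ := by
      rw [← mul_one (m j)⁻¹, le_inv_mul_iff₀ (hm j)]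
      exact (hb j x hj).1.trans hx1
    exact h1.trans (Finset.single_le_sum (f := fun j => (m j)⁻¹)
      (fun j _ => (inv_pos.2 (hm j)).le) (Finset.mem_univ j))
  let S : V → ℝ := fun v' => sSup ((fun x : V => ⟪x, v'⟫) '' U)
  have hS : ∀ v', IsLUB ((fun x : V => ⟪x, v'⟫) '' U) (S v') := by
    intro v'
    refine isLUB_csSup ⟨_, 0, h0U, rfl⟩ ⟨R * ‖v'‖, ?_⟩
    rintro _ ⟨x, hx, rfl⟩
    exact (real_inner_le_norm x v').trans
      (mul_le_mul_of_nonneg_right (hUR x hx) (norm_nonneg _))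
  have hle : ∀ v', ∀ x ∈ U, ⟪x, v'⟫ ≤ S v' := fun v' x hx => (hS v').1 ⟨x, hx, rfl⟩
  have hSle : ∀ v' r, (∀ x ∈ U, ⟪x, v'⟫ ≤ r) → S v' ≤ r := by
    intro v' r h
    refine (hS v').2 ?_
    rintro _ ⟨x, hx, rfl⟩
    exact h x hx
  have habs : ∀ v', ∀ x ∈ U, |⟪x, v'⟫| ≤ S v' := by
    intro v' x hx
    refine abs_le'.2 ⟨hle v' x hx, ?_⟩
    rw [← inner_neg_left]
    exact hle v' _ (hneg x hx)
  have hUA : U ⊆ {v : V | N v ≤ 1} := by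
    rw [hball]; exact (subset_convexHull ℝ U).trans subset_closure
  have hA : ∀ v', ∀ x ∈ {v : V | N v ≤ 1}, ⟪x, v'⟫ ≤ S v' := by
    intro v' x hx
    rw [hball] at hx
    have hcv : Convex ℝ {x : V | ⟪x, v'⟫ ≤ S v'} := by
      intro a ha b hb s t hs ht hst
      simp only [Set.mem_setOf_eq] at ha hb ⊢
      rw [inner_add_left, real_inner_smul_left, real_inner_smul_left]
      have h1 := mul_le_mul_of_nonneg_left ha hs
      have h2 := mul_le_mul_of_nonneg_left hb ht
      have h3 : S v' = s * S v' + t * S v' := by rw [← add_mul, hst, one_mul]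
      linarith
    have hcl : IsClosed {x : V | ⟪x, v'⟫ ≤ S v'} :=
      isClosed_le (by fun_prop) continuous_const
    exact closure_minimal (convexHull_min (fun y hy => hle v' y hy) hcv) hcl hx
  have hSA : ∀ v', IsLUB ((fun x : V => ⟪x, v'⟫) '' {v : V | N v ≤ 1}) (S v') := by
    intro v'
    constructor
    · rintro _ ⟨x, hx, rfl⟩
      exact hA v' x hx
    · intro r hr
      exact hSle v' r fun x hx => hr ⟨x, hUA hx, rfl⟩
  obtain ⟨C, hC, hNC⟩ := aux_bound N hN (by rw [hball]; exact isClosed_closure)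
  have hS0 : ∀ v, 0 ≤ S v := fun v => by simpa using hle v 0 h0U
  have hlow : ∀ v, C⁻¹ * ‖v‖ ≤ S v := by
    intro v
    by_cases hv : v = 0
    · subst hv; simpa using hS0 0
    have hv' : 0 < ‖v‖ := norm_pos_iff.2 hv
    have hpos : 0 < C * ‖v‖ := mul_pos hC hv'
    have h1 : N ((C * ‖v‖)⁻¹ • v) ≤ 1 := by
      rw [hN.2.2.1, abs_of_pos (inv_pos.2 hpos), inv_mul_le_iff₀ hpos, mul_one]
      exact hNC v
    have h2 := hA v _ h1
    rw [real_inner_smul_left, real_inner_self_eq_norm_sq] at h2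
    refine le_trans (le_of_eq ?_) h2
    field_simp
  have hup : ∀ v, S v ≤ R * ‖v‖ := by
    intro v
    refine hSle _ _ fun x hx => (real_inner_le_norm x v).trans
      (mul_le_mul_of_nonneg_right (hUR x hx) (norm_nonneg _))
  have hsm : ∀ (c : ℝ) v, S (c • v) ≤ |c| * S v := by
    intro c v
    refine hSle _ _ fun x hx => ?_
    rw [real_inner_smul_right]
    refine (le_abs_self _).trans ?_
    rw [abs_mul]
    exact mul_le_mul_of_nonneg_left (habs v x hx) (abs_nonneg c)
  refine ⟨S, fun v' => aux_coe_iSup _ _ _ (hSA v'), ?_, ⟨hS0, ?_, ?_, ?_⟩,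
    ⟨C⁻¹, R, inv_pos.2 hC, hR, fun v => ⟨hlow v, hup v⟩⟩, ?_⟩
  · intro v'
    rw [aux_coe_iSup _ _ _ (hS v'), hU, iSup_iUnion]
    refine iSup_congr fun j => iSup_congr fun v => iSup_congr fun hv => ?_
    have h1 := (hπ j v').2 v hv.1
    rw [inner_sub_left, sub_eq_zero, real_inner_comm, real_inner_comm v (π j v')] at h1
    rw [h1]
  · intro v
    constructor
    · intro h
      have h1 := hlow v
      rw [h] at h1
      have h2 : ‖v‖ ≤ 0 := by
        by_contra h3
        exact absurd (mul_pos (inv_pos.2 hC) (not_le.1 h3)) (not_lt.2 h1)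
      exact norm_le_zero_iff.1 h2
    · rintro rfl
      exact le_antisymm (by simpa using hup 0) (hS0 0)
  · intro c v
    apply le_antisymm (hsm c v)
    by_cases hc : c = 0
    · subst hc; simpa using hS0 0
    have h1 := hsm c⁻¹ (c • v)
    rw [inv_smul_smul₀ hc, abs_inv, le_inv_mul_iff₀ (abs_pos.2 hc)] at h1
    exact h1
  · intro v w
    refine hSle _ _ fun x hx => ?_
    rw [inner_add_right]
    exact add_le_add (hle v x hx) (hle w x hx)
  · ext y
    exact ⟨fun h x hx => (hle y x hx).trans h, fun h => hSle y 1 h⟩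
end

section
/- Let 𝕍 be a real Hilbert space and 𝕁 a finite nonempty set. Assume: (1) {W_j}_{j∈𝕁} are pairwise disjoint symmetric subsets of 𝕍 such that the closed subspaces 𝕍_j := closure(span W_j) have algebraic sum equal to 𝕍; (2) for each j, ‖·‖_j is a norm on 𝕍_j equivalent to the restriction of the Hilbertian norm to 𝕍_j, with unit ball B_j = {w ∈ 𝕍_j : ‖w‖_j ≤ 1} and unit sphere S_j = {w ∈ 𝕍_j : ‖w‖_j = 1}; (3) {θ_j}_{j∈𝕁} are odd mappings θ_j : W_j → 𝕍 (θ_j(−w) = −θ_j(w)) with S_j ⊆ closure(θ_j(W_j)) ⊆ B_j; (4) h : 𝕍 → ℝ̄ is such that each (θ_j▷h)* is proper and ⋂_{j∈𝕁} dom((θ_j▷h)*) ≠ ∅, where (θ_j▷h)(x) = inf{h(w) : w ∈ W_j, θ_j(w) = x}. Then there exists a norm N on 𝕍 whose closed unit ball {w : N(w) ≤ 1} equals the closed convex hull of ⋃_{j∈𝕁} B_j, such that the infimum of (sup_{j∈𝕁} (θ_j▷h)*)*' over {w : N(w) ≤ 1} is attained and min_{N(w) ≤ 1} (sup_{j∈𝕁}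 (θ_j▷h)*)*'(w) ≤ inf{ h(w) : w ∈ ⋃_{j∈𝕁} W_j }. -/
open scoped RealInnerProductSpace

/-- The Fenchel conjugate `(θⱼ▷h)*` of the restricted infimal postcomposition
`(θⱼ▷h)(x) = inf {h w : w ∈ Wⱼ, θⱼ w = x}` (with `inf ∅ = ⊤`), computed with the
Moreau lower addition, i.e. `EReal` addition (`⊤ + ⊥ = ⊥`). -/
noncomputable def pconj {X W' : Type*} [NormedAddCommGroup X] [InnerProductSpace ℝ X]
    (h : W' → EReal) (Wj : Set W') (θj : W' → X) (y : X) : EReal :=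
  ⨆ x : X, ((⟪x, y⟫ : EReal) + (-(⨅ w ∈ {w | w ∈ Wj ∧ θj w = x}, h w)))

/-- The reverse Fenchel conjugate `g*'(x) = ⨆ y, ⟪x,y⟫ + (− g y)`. -/
noncomputable def rconj {X : Type*} [NormedAddCommGroup X] [InnerProductSpace ℝ X]
    (g : X → EReal) (x : X) : EReal :=
  ⨆ y : X, ((⟪x, y⟫ : EReal) + (-(g y)))

theorem aux_weak {V : Type*} [NormedAddCommGroup V] [InnerProductSpace ℝ V]
    [CompleteSpace V] (C : Set V) (hconv : Convex ℝ C) (hcl : IsClosed C)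
    (hne : C.Nonempty) (hb : Bornology.IsBounded C) (g : V → EReal) :
    ∃ w₀ ∈ C, ∀ w ∈ C, rconj g w₀ ≤ rconj g w := by
  let e : WeakDual ℝ V → V := fun f =>
    (InnerProductSpace.toDual ℝ V).symm (WeakDual.toStrongDual f)
  let e' : V → WeakDual ℝ V := fun v =>
    StrongDual.toWeakDual (InnerProductSpace.toDual ℝ V v)
  have hee : ∀ v, e (e' v) = v := fun v => by simp [e, e']
  have he : ∀ f y, ⟪e f, y⟫ = f y := fun f y => by
    simp only [e, InnerProductSpace.toDual_symm_apply]; rfl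
  have hcont : ∀ y, Continuous fun f => ⟪e f, y⟫ := fun y => by
    simp only [he]; exact WeakDual.eval_continuous y
  obtain ⟨R, hR⟩ := hb.exists_norm_le
  have hclosed : IsClosed (e ⁻¹' C) := by
    rw [← isOpen_compl_iff, isOpen_iff_mem_nhds]
    intro f hf
    obtain ⟨l, u, h1, h2⟩ := geometric_hahn_banach_closed_point hconv hcl hf
    have hl : ∀ x, l x = ⟪x, (InnerProductSpace.toDual ℝ V).symm l⟫ := fun x => by
      rw [real_inner_comm, InnerProductSpace.toDual_symm_apply]
    have ho : IsOpen {f | u < ⟪e f, (InnerProductSpace.toDual ℝ V).symm l⟫} :=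
      isOpen_lt continuous_const (hcont _)
    refine Filter.mem_of_superset (ho.mem_nhds (by simpa [← hl] using h2)) ?_
    intro f' hf' hc
    have := h1 _ hc
    rw [hl] at this
    exact lt_asymm this hf'
  have hcomp : IsCompact (e ⁻¹' C) := by
    refine (WeakDual.isCompact_closedBall (𝕜 := ℝ) (E := V) 0 R).of_isClosed_subset hclosed ?_
    intro f hf
    have := hR _ hf
    simpa [e] using this
  have hlsc : LowerSemicontinuousOn (fun f => rconj g (e f)) (e ⁻¹' C) := by
    apply LowerSemicontinuous.lowerSemicontinuousOn
    unfold rconj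
    apply lowerSemicontinuous_iSup
    intro y
    generalize -(g y) = c
    have hc : Continuous fun f => ((⟪e f, y⟫ : ℝ) : EReal) :=
      continuous_coe_real_ereal.comp (hcont y)
    induction c with
    | bot => simpa using lowerSemicontinuous_const
    | top => simpa using lowerSemicontinuous_const
    | coe r =>
      simp only [← EReal.coe_add]
      exact (continuous_coe_real_ereal.comp ((hcont y).add continuous_const)).lowerSemicontinuous
  obtain ⟨v, hv⟩ := hne
  obtain ⟨f, hf, hmin⟩ := hlsc.exists_isMinOn (s := e ⁻¹' C) ⟨e' v, by simpa [hee] using hv⟩ hcomp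
  refine ⟨e f, hf, fun w hw => ?_⟩
  have := hmin (show e' w ∈ e ⁻¹' C by simpa [hee] using hw)
  simpa [hee] using this

theorem aux_nhds {V J : Type*} [NormedAddCommGroup V] [InnerProductSpace ℝ V]
    [CompleteSpace V] [Fintype J] [Nonempty J] (p : J → Submodule ℝ V)
    (hp : ∀ j, IsClosed (p j : Set V))
    (hsum : ∀ v : V, ∃ c : J → V, (∀ j : J, c j ∈ p j) ∧ ∑ j : J, c j = v)
    (Nj : J → V → ℝ) (hNj : ∀ j : J, IsEquivNormOn (p j) (Nj j)) :
    convexHull ℝ (⋃ j : J, {v : V | v ∈ p j ∧ Nj j v ≤ 1}) ∈ nhds (0 : V) := by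
  have : ∀ j, CompleteSpace (p j) := fun j => (hp j).completeSpace_coe
  let T : (∀ j, p j) →L[ℝ] V :=
    ∑ j, (p j).subtypeL.comp (ContinuousLinearMap.proj (R := ℝ) (φ := fun j => p j) j)
  have hT : ∀ c, T c = ∑ j, (c j : V) := fun c => by simp [T]
  have hsurj : Function.Surjective T := fun v => by
    obtain ⟨c, hc, h⟩ := hsum v
    exact ⟨fun j => ⟨c j, hc j⟩, by simpa [hT] using h⟩
  choose m M hm hM hb using fun j => (hNj j).2.2.2.2
  let n : ℝ := Fintype.card J
  have hn : 0 < n := by simp [n, Fintype.card_pos]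
  have hU : {c : ∀ j, p j | ∀ j, M j * (n * ‖c j‖) < 1} ∈ nhds (0 : ∀ j, p j) := by
    refine Filter.eventually_all.2 fun j => ?_
    have hc : Continuous fun c : ∀ j, p j => M j * (n * ‖c j‖) := by fun_prop
    exact (isOpen_lt hc continuous_const).mem_nhds (by simp)
  have := (T.isOpenMap hsurj).image_mem_nhds hU
  rw [map_zero] at this
  refine Filter.mem_of_superset this ?_
  rintro _ ⟨c, hc, rfl⟩
  have hs : T c = ∑ j, n⁻¹ • (n • (c j : V)) := by
    rw [hT]
    refine Finset.sum_congr rfl fun j _ => ?_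
    rw [smul_smul, inv_mul_cancel₀ hn.ne', one_smul]
  rw [hs]
  refine (convex_convexHull ℝ _).sum_mem (fun _ _ => by positivity) ?_ ?_
  · simp only [Finset.sum_const, Finset.card_univ, nsmul_eq_mul]
    exact mul_inv_cancel₀ hn.ne'
  · intro j _
    refine subset_convexHull ℝ _ (Set.mem_iUnion.2 ⟨j, (p j).smul_mem _ (c j).2, ?_⟩)
    refine ((hb j _ ((p j).smul_mem n (c j).2)).2).trans ?_
    rw [norm_smul, Real.norm_of_nonneg hn.le]
    exact (hc j).le

theorem aux_le {V J : Type*} [NormedAddCommGroup V] [InnerProductSpace ℝ V]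
    (W : J → Set V) (θ : J → V → V) (h : V → EReal) (j : J) (w : V) (hw : w ∈ W j) :
    rconj (fun y => ⨆ j : J, pconj h (W j) (θ j) y) (θ j w) ≤ h w := by
  refine iSup_le fun y => ?_
  have h1 : ((⟪θ j w, y⟫ : ℝ) : EReal) + (-(h w)) ≤ ⨆ j : J, pconj h (W j) (θ j) y := by
    refine le_trans ?_ (le_iSup _ j)
    refine le_trans ?_ (le_iSup _ (θ j w))
    refine add_le_add le_rfl (EReal.neg_le_neg_iff.2 ?_)
    exact iInf₂_le w ⟨hw, rfl⟩
  refine (add_le_add le_rfl (EReal.neg_le_neg_iff.2 h1)).trans ?_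
  generalize h w = c
  generalize (⟪θ j w, y⟫ : ℝ) = a
  induction c with
  | bot => simp
  | top => simp
  | coe r =>
    norm_cast
    simp

/-- `𝕍` a real Hilbert space, `𝕁` finite nonempty; `{W_j}` pairwise
disjoint symmetric subsets of `𝕍` whose closed spans `𝕍_j` have algebraic sum `𝕍`;
`‖·‖_j` a norm on `𝕍_j` equivalent to the restricted Hilbertian norm, with unit ball
`B_j` and unit sphere `S_j`; `θ_j : W_j → 𝕍` odd with
`S_j ⊆ closure (θ_j(W_j)) ⊆ B_j`; `h : 𝕍 → ℝ̄` with each `(θ_j▷h)*` proper and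
common nonempty domain.  Then there is a norm `N` with closed unit ball the closed
convex hull of `⋃_j B_j` such that the infimum of `(sup_j (θ_j▷h)*)*'` over this ball
is attained and is `≤ inf { h w : w ∈ ⋃_j W_j }`. -/
theorem stmt_10 {V J : Type*} [NormedAddCommGroup V] [InnerProductSpace ℝ V]
    [CompleteSpace V] [Fintype J] [Nonempty J]
    (W : J → Set V)
    (hdisj : Pairwise fun j j' : J => Disjoint (W j) (W j'))
    (hsymm : ∀ j : J, -(W j) = W j)
    (hsum : ∀ v : V, ∃ c : J → V,
      (∀ j : J, c j ∈ (Submodule.span ℝ (W j)).topologicalClosure) ∧ ∑ j : J, c j = v)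
    (Nj : J → V → ℝ)
    (hNj : ∀ j : J, IsEquivNormOn (Submodule.span ℝ (W j)).topologicalClosure (Nj j))
    (θ : J → V → V)
    (hodd : ∀ j : J, ∀ w ∈ W j, θ j (-w) = -θ j w)
    (hθ : ∀ j : J,
      {v : V | v ∈ (Submodule.span ℝ (W j)).topologicalClosure ∧ Nj j v = 1}
          ⊆ closure (θ j '' W j) ∧
      closure (θ j '' W j)
          ⊆ {v : V | v ∈ (Submodule.span ℝ (W j)).topologicalClosure ∧ Nj j v ≤ 1})
    (h : V → EReal)
    (hproper : ∀ j : J,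
      (∀ y : V, pconj h (W j) (θ j) y ≠ ⊥) ∧ ∃ y : V, pconj h (W j) (θ j) y ≠ ⊤)
    (hdom : ∃ y : V, ∀ j : J, pconj h (W j) (θ j) y ≠ ⊤) :
    ∃ N : V → ℝ, IsNorm N ∧
      {v : V | N v ≤ 1} = closure (convexHull ℝ (⋃ j : J,
        {v : V | v ∈ (Submodule.span ℝ (W j)).topologicalClosure ∧ Nj j v ≤ 1})) ∧
      ∃ w₀ : V, N w₀ ≤ 1 ∧
        (∀ w : V, N w ≤ 1 →
          rconj (fun y => ⨆ j : J, pconj h (W j) (θ j) y) w₀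
            ≤ rconj (fun y => ⨆ j : J, pconj h (W j) (θ j) y) w) ∧
        rconj (fun y => ⨆ j : J, pconj h (W j) (θ j) y) w₀ ≤ ⨅ w ∈ ⋃ j : J, W j, h w := by
  set p : J → Submodule ℝ V := fun j => (Submodule.span ℝ (W j)).topologicalClosure with hpdef
  set B : Set V := ⋃ j : J, {v : V | v ∈ p j ∧ Nj j v ≤ 1} with hB
  have hp : ∀ j, IsClosed (p j : Set V) := fun j => Submodule.isClosed_topologicalClosure _
  have hnh : convexHull ℝ B ∈ nhds (0 : V) := aux_nhds p hp hsum Nj hNj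
  have hnC : closure (convexHull ℝ B) ∈ nhds (0 : V) := Filter.mem_of_superset hnh subset_closure
  have hcC : Convex ℝ (closure (convexHull ℝ B)) := (convex_convexHull ℝ B).closure
  have hbB : Bornology.IsBounded B := by
    rw [hB, Bornology.isBounded_iUnion]
    intro j
    obtain ⟨m, M, hm, hM, hb⟩ := (hNj j).2.2.2.2
    refine isBounded_iff_forall_norm_le.2 ⟨1 / m, ?_⟩
    rintro v ⟨hv, hv1⟩
    rw [le_div_iff₀' hm]
    exact (hb v hv).1.trans hv1
  have hbC : Bornology.IsBounded (closure (convexHull ℝ B)) :=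
    (isBounded_convexHull.2 hbB).closure
  have hnegB : ∀ x ∈ B, -x ∈ B := by
    intro x hx
    obtain ⟨j, hj, hj1⟩ := Set.mem_iUnion.1 hx
    refine Set.mem_iUnion.2 ⟨j, (p j).neg_mem hj, ?_⟩
    have := (hNj j).2.2.1 (-1) x hj
    simp only [neg_smul, one_smul, abs_neg, abs_one, one_mul] at this
    rw [this]; exact hj1
  have hnegH : ∀ x ∈ convexHull ℝ B, -x ∈ convexHull ℝ B := by
    intro x hx
    have h1 : -x ∈ -convexHull ℝ B := by simpa using hx
    rw [← convexHull_neg] at h1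
    exact convexHull_mono (fun y hy => by simpa using hnegB _ hy) h1
  have hnegC : ∀ x ∈ closure (convexHull ℝ B), -x ∈ closure (convexHull ℝ B) := by
    intro x hx
    exact map_mem_closure continuous_neg hx hnegH
  have habs : Absorbent ℝ (closure (convexHull ℝ B)) := absorbent_nhds_zero hnC
  have hball : ∀ v, gauge (closure (convexHull ℝ B)) v ≤ 1 ↔ v ∈ closure (convexHull ℝ B) := by
    intro v
    rw [gauge_le_one_iff_mem_closure hcC hnC, closure_closure]
  obtain ⟨w₀, hw₀, hmin⟩ := aux_weak _ hcC isClosed_closure ⟨0, mem_of_mem_nhds hnC⟩ hbC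
    (fun y => ⨆ j : J, pconj h (W j) (θ j) y)
  refine ⟨gauge (closure (convexHull ℝ B)), ⟨fun v => gauge_nonneg v, fun v => ?_, fun c v => ?_,
    fun v w => gauge_add_le hcC habs v w⟩, ?_, w₀, (hball _).2 hw₀,
    fun w hw => hmin w ((hball _).1 hw), ?_⟩
  · constructor
    · intro h0
      by_contra hv
      exact ((gauge_pos habs ((NormedSpace.isVonNBounded_iff ℝ).2 hbC)).2 hv).ne' h0
    · rintro rfl
      exact gauge_zero
  · have := gauge_smul (𝕜 := ℝ) (s := closure (convexHull ℝ B)) ?_ c v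
    · simpa using this
    · exact (balanced_iff_neg_mem hcC).2 (fun {x} hx => hnegC x hx)
  · ext v
    exact hball v
  · refine le_iInf₂ fun w hw => ?_
    obtain ⟨j, hj⟩ := Set.mem_iUnion.1 hw
    refine (hmin (θ j w) ?_).trans (aux_le W θ h j w hj)
    refine subset_closure (subset_convexHull ℝ _ (Set.mem_iUnion.2 ⟨j, ?_⟩))
    exact (hθ j).2 (subset_closure ⟨w, hj, rfl⟩)
end
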